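/- arXiv:1803.05643 — 3 statements merged into one kernel-verified Lean document; each statement's English description precedes it below -/
import Mathlib

section
/- Let G=(V,E) be a finite simple graph with |V|=n vertices that is d-regular, and suppose each local code C_u ⊆ F_2^{Γ(u)} satisfies dim C_u ≥ r·d for a real number r. Then the graph code C = C(G,{C_u}) ⊆ F_2^E satisfies dim C ≥ (2r−1)·|E| = (2r−1)·nd/2; in particular its rate satisfies r(C) ≥ 2r−1. (Rate part of the Sipser–Spielman theorem.) -/
open Finset Module

/-- The linear map restricting an assignment of `F₂`-values on the edges of `G`
to the local view at a vertex `u`. -/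
def SimpleGraph.localRestrict {V : Type} [Fintype V] [DecidableEq V]
    (G : SimpleGraph V) [DecidableRel G.Adj] (u : V) :
    (↥G.edgeSet → ZMod 2) →ₗ[ZMod 2] (↥(G.neighborSet u) → ZMod 2) where
  toFun x v := x ⟨s(u, (v : V)), v.2⟩
  map_add' _ _ := rfl
  map_smul' _ _ := rfl

/-- The graph code `C(G, {C_u})`. -/
def SimpleGraph.graphCode {V : Type} [Fintype V] [DecidableEq V]
    (G : SimpleGraph V) [DecidableRel G.Adj]
    (C : ∀ u : V, Submodule (ZMod 2) (↥(G.neighborSet u) → ZMod 2)) :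
    Submodule (ZMod 2) (↥G.edgeSet → ZMod 2) :=
  ⨅ u : V, (C u).comap (G.localRestrict u)

/-- An intersection of preimages of subspaces has codimension at most the sum of their
codimensions. -/
theorem finrank_le_finrank_iInf_comap_add_sum {K E ι : Type*} [Field K] [AddCommGroup E]
    [Module K E] [FiniteDimensional K E] [Fintype ι] {M : ι → Type*} [∀ i, AddCommGroup (M i)]
    [∀ i, Module K (M i)] [∀ i, FiniteDimensional K (M i)] (f : ∀ i, E →ₗ[K] M i)
    (C : ∀ i, Submodule K (M i)) :
    finrank K E ≤ finrank K ↥(⨅ i, (C i).comap (f i)) + ∑ i, finrank K (M i ⧸ C i) := by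
  have hker : LinearMap.ker (LinearMap.pi fun i => (C i).mkQ ∘ₗ f i) =
      ⨅ i, (C i).comap (f i) := by
    simp [LinearMap.ker_pi, LinearMap.ker_comp]
  have hrank := (LinearMap.pi fun i => (C i).mkQ ∘ₗ f i).finrank_range_add_finrank_ker
  have hle := (LinearMap.range (LinearMap.pi fun i => (C i).mkQ ∘ₗ f i)).finrank_le
  rw [finrank_pi_fintype] at hle
  rw [hker] at hrank
  omega

/-- Rate part of the Sipser–Spielman theorem: if `G` is a `d`-regular graph
on `n` vertices and each local code satisfies `dim C_u ≥ r·d`, then the graph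
code `C = C(G, {C_u})` satisfies `dim C ≥ (2r−1)·|E|`, where `|E| = nd/2`;
in particular `r(C) ≥ 2r − 1`. -/
theorem graphCode_rate {V : Type} [Fintype V] [DecidableEq V]
    (G : SimpleGraph V) [DecidableRel G.Adj] (d : ℕ)
    (hreg : G.IsRegularOfDegree d) (r : ℝ)
    (C : ∀ u : V, Submodule (ZMod 2) (↥(G.neighborSet u) → ZMod 2))
    (hdim : ∀ u : V, r * d ≤ (finrank (ZMod 2) (C u) : ℝ)) :
    (2 * r - 1) * G.edgeFinset.card ≤ (finrank (ZMod 2) (G.graphCode C) : ℝ) ∧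
      (G.edgeFinset.card : ℝ) = Fintype.card V * d / 2 := by
  have hcard : (G.edgeFinset.card : ℝ) = Fintype.card V * d / 2 := by
    have h := G.sum_degrees_eq_twice_card_edges
    simp only [hreg.degree_eq, sum_const, card_univ, smul_eq_mul] at h
    have h' : (Fintype.card V * d : ℝ) = 2 * G.edgeFinset.card := mod_cast h
    linarith
  refine ⟨?_, hcard⟩
  have hquot (u : V) : (finrank (ZMod 2) ((↥(G.neighborSet u) → ZMod 2) ⧸ C u) : ℝ) ≤
      d - r * d := by
    have h := (C u).finrank_quotient_add_finrank
    rw [finrank_fintype_fun_eq_card, G.card_neighborSet_eq_degree, hreg.degree_eq] at h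
    have h' : (finrank (ZMod 2) ((↥(G.neighborSet u) → ZMod 2) ⧸ C u) : ℝ) +
        finrank (ZMod 2) (C u) = d := mod_cast h
    linarith [hdim u]
  have hsum := Finset.sum_le_sum fun u (_ : u ∈ univ) => hquot u
  rw [sum_const, card_univ, nsmul_eq_mul] at hsum
  have hmain := finrank_le_finrank_iInf_comap_add_sum G.localRestrict C
  rw [finrank_fintype_fun_eq_card, ← G.edgeFinset_card] at hmain
  have hmain' : (G.edgeFinset.card : ℝ) ≤ finrank (ZMod 2) (G.graphCode C) +
      ∑ u, (finrank (ZMod 2) ((↥(G.neighborSet u) → ZMod 2) ⧸ C u) : ℝ) := mod_cast hmain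
  have hnd : (Fintype.card V : ℝ) * (d - r * d) = 2 * G.edgeFinset.card * (1 - r) := by
    rw [hcard]
    ring
  linarith
end

section
/- Let G=(V,E) be a d-regular finite simple graph on n vertices whose adjacency matrix A satisfies the spectral bound x^T A x ≤ λ·‖x‖² for every vector x ∈ ℝ^V with Σ_{v∈V} x_v = 0 (i.e., λ(G) ≤ λ, where λ(G) is the second largest adjacency eigenvalue), with 0 ≤ λ < d. Suppose every local code C_u ⊆ F_2^{Γ(u)} has relative distance at least δ, i.e., every nonzero y ∈ C_u has Hamming weight |y| ≥ δ·d, and suppose δ > λ/d. Then every nonzero codeword x of the graph code C = C(G,{C_u}) has Hamming weight |x| ≥ ((δ−λ/d)/(1−λ/d))²·|E|; in particular the relative distance satisfies δ(C) ≥ ((δ−λ/d)/(1−λ/d))². (Distance part of the Sipser–Spielman theorem.) -/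
open Finset Module Matrix

namespace SimpleGraph

variable {V : Type} [Fintype V] (G : SimpleGraph V) [DecidableRel G.Adj]

/-- The subgraph of `G` consisting of the edges on which `x` is nonzero. -/
def supportGraph (x : ↥G.edgeSet → ZMod 2) : SimpleGraph V where
  Adj u v := ∃ h : G.Adj u v, x ⟨s(u, v), h⟩ ≠ 0
  symm := ⟨fun u v ⟨h, hx⟩ => ⟨h.symm, by
    have e : (⟨s(v, u), h.symm⟩ : G.edgeSet) = ⟨s(u, v), h⟩ := Subtype.ext Sym2.eq_swap
    rwa [e]⟩⟩
  loopless := ⟨fun u ⟨h, _⟩ => G.loopless.irrefl u h⟩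

open scoped Classical in
theorem degree_supportGraph [DecidableEq V] (x : ↥G.edgeSet → ZMod 2) (u : V) :
    (G.supportGraph x).degree u = hammingNorm (G.localRestrict u x) := by
  rw [← card_neighborFinset_eq_degree, hammingNorm,
    ← Finset.card_map (Function.Embedding.subtype _)]
  congr 1
  ext v
  rw [mem_neighborFinset]
  simp only [Finset.mem_map, Finset.mem_filter, Finset.mem_univ, true_and]
  simp [supportGraph, localRestrict]

open scoped Classical in
theorem card_edgeFinset_supportGraph (x : ↥G.edgeSet → ZMod 2) :
    (G.supportGraph x).edgeFinset.card = hammingNorm x := by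
  rw [hammingNorm, ← Finset.card_map (Function.Embedding.subtype _)]
  congr 1
  ext e
  induction e with
  | _ u v =>
    rw [mem_edgeFinset, mem_edgeSet]
    simp [supportGraph]

/-- The number of edges on which `x` is nonzero, counted through local views. -/
theorem sum_hammingNorm_localRestrict [DecidableEq V] (x : ↥G.edgeSet → ZMod 2) :
    ∑ u, hammingNorm (G.localRestrict u x) = 2 * hammingNorm x := by
  classical
  rw [← card_edgeFinset_supportGraph, ← sum_degrees_eq_twice_card_edges]
  exact Finset.sum_congr rfl fun u _ => (G.degree_supportGraph x u).symm

/-- The weight of the local view at `u` is at most the number of neighbors of `u` whose local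
view is nonzero. -/
theorem hammingNorm_localRestrict_le [DecidableEq V] (x : ↥G.edgeSet → ZMod 2) (u : V) :
    hammingNorm (G.localRestrict u x) ≤
      #{v ∈ G.neighborFinset u | G.localRestrict v x ≠ 0} := by
  classical
  rw [← degree_supportGraph, ← card_neighborFinset_eq_degree]
  refine Finset.card_le_card fun v hv => ?_
  rw [mem_neighborFinset] at hv
  obtain ⟨h, hx⟩ := hv.symm
  simp only [Finset.mem_filter, mem_neighborFinset]
  exact ⟨h.symm, fun h0 => hx (congrFun h0 ⟨u, h⟩)⟩

/-- Expander mixing for a single vertex set: in a `d`-regular graph with spectral bound `lam`,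
the quadratic form of the indicator of `S` is at most `d |S|² / n + lam (|S| - |S|² / n)`. -/
theorem card_mul_sum_card_filter_neighborFinset_le [DecidableEq V] {d : ℕ}
    (hreg : G.IsRegularOfDegree d) {lam : ℝ}
    (hspec : ∀ f : V → ℝ, ∑ v : V, f v = 0 →
      f ⬝ᵥ ((G.adjMatrix ℝ) *ᵥ f) ≤ lam * ∑ v : V, (f v) ^ 2)
    [Nonempty V] (S : Finset V) :
    (Fintype.card V : ℝ) * ∑ u ∈ S, (#{v ∈ G.neighborFinset u | v ∈ S} : ℝ) ≤
      d * (#S : ℝ) ^ 2 + lam * #S * (Fintype.card V - #S) := by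
  have hn : (0 : ℝ) < Fintype.card V := by exact_mod_cast Fintype.card_pos
  set n : ℝ := (Fintype.card V : ℝ) with hn_def
  set k : ℝ := (#S : ℝ) with hk_def
  let g : V → ℝ := fun v => if v ∈ S then 1 else 0
  have hg : ∑ v, g v = k := by simp [g, hk_def]
  have hA1 : ∀ c : ℝ, (G.adjMatrix ℝ) *ᵥ (fun _ => c) = fun _ => d * c := by
    intro c; ext v
    simp [adjMatrix_mulVec_apply, hreg.degree_eq v]
  have hAg : g ⬝ᵥ ((G.adjMatrix ℝ) *ᵥ g) =
      ∑ u ∈ S, (#{v ∈ G.neighborFinset u | v ∈ S} : ℝ) := by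
    simp [dotProduct, adjMatrix_mulVec_apply, g, Finset.filter_mem_eq_inter]
  have hAgsum : ∑ v, ((G.adjMatrix ℝ) *ᵥ g) v = d * k := by
    have h := dotProduct_mulVec (fun _ => (1 : ℝ)) (G.adjMatrix ℝ) g
    rw [← mulVec_transpose, transpose_adjMatrix, hA1] at h
    simp only [dotProduct, one_mul, mul_one, ← Finset.mul_sum, hg] at h
    exact h
  have h := hspec (g - fun _ => k / n) (by
    simp only [Pi.sub_apply, Finset.sum_sub_distrib, hg]
    simp [← hn_def]; field_simp; ring)
  have hsq : ∑ v, ((g - fun _ : V => k / n : V → ℝ) v) ^ 2 = k - k ^ 2 / n := by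
    have e : ∀ v, ((g - fun _ : V => k / n : V → ℝ) v) ^ 2 =
        g v - 2 * (k / n) * g v + (k / n) ^ 2 := by
      intro v
      have : g v ^ 2 = g v := by by_cases hv : v ∈ S <;> simp [g, hv]
      simp only [Pi.sub_apply]
      linear_combination this
    simp only [e, Finset.sum_add_distrib, Finset.sum_sub_distrib, ← Finset.mul_sum, hg]
    simp [← hn_def]; field_simp; ring
  have hform : (g - fun _ : V => k / n : V → ℝ) ⬝ᵥ
        ((G.adjMatrix ℝ) *ᵥ (g - fun _ : V => k / n : V → ℝ)) =
      g ⬝ᵥ ((G.adjMatrix ℝ) *ᵥ g) - d * k ^ 2 / n := by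
    rw [mulVec_sub, hA1, sub_dotProduct, dotProduct_sub, dotProduct_sub]
    have h1 : g ⬝ᵥ (fun _ => (d : ℝ) * (k / n)) = k * (d * (k / n)) := by
      simp only [dotProduct, ← Finset.sum_mul, hg]
    have h2 : (fun _ => k / n) ⬝ᵥ ((G.adjMatrix ℝ) *ᵥ g) = k / n * (d * k) := by
      simp only [dotProduct, ← Finset.mul_sum, hAgsum]
    have h3 : (fun _ : V => k / n) ⬝ᵥ (fun _ => (d : ℝ) * (k / n)) =
        n * (k / n * (d * (k / n))) := by
      simp [dotProduct, ← hn_def]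
    rw [h1, h2, h3]; field_simp; ring
  rw [hsq, hform, hAg] at h
  have h' := mul_le_mul_of_nonneg_left h hn.le
  have e1 : ∀ q : ℝ, n * (q - d * k ^ 2 / n) = n * q - d * k ^ 2 := by
    intro q; field_simp
  have e2 : n * (lam * (k - k ^ 2 / n)) = lam * k * (n - k) := by
    field_simp
  rw [e1, e2] at h'
  linarith

end SimpleGraph

/-- Distance part of the Sipser–Spielman theorem: if `G` is a `d`-regular graph
whose second adjacency eigenvalue is at most `λ` (encoded by the quadratic form
bound `xᵀAx ≤ λ‖x‖²` on vectors summing to zero), `0 ≤ λ < d`, and each local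
code has relative distance at least `δ > λ/d`, then every nonzero codeword of
the graph code has Hamming weight at least `((δ−λ/d)/(1−λ/d))²·|E|`; in
particular `δ(C) ≥ ((δ−λ/d)/(1−λ/d))²`. -/
theorem graphCode_distance {V : Type} [Fintype V] [DecidableEq V]
    (G : SimpleGraph V) [DecidableRel G.Adj] (d : ℕ)
    (hreg : G.IsRegularOfDegree d) (lam δ : ℝ)
    (hlam0 : 0 ≤ lam) (hlamd : lam < d)
    (hspec : ∀ f : V → ℝ, ∑ v : V, f v = 0 →
      f ⬝ᵥ ((G.adjMatrix ℝ) *ᵥ f) ≤ lam * ∑ v : V, (f v) ^ 2)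
    (C : ∀ u : V, Submodule (ZMod 2) (↥(G.neighborSet u) → ZMod 2))
    (hdist : ∀ u : V, ∀ y ∈ C u, y ≠ 0 → δ * d ≤ (hammingNorm y : ℝ))
    (hδ : lam / d < δ) :
    ∀ x ∈ G.graphCode C, x ≠ 0 →
      ((δ - lam / d) / (1 - lam / d)) ^ 2 * G.edgeFinset.card ≤ (hammingNorm x : ℝ) := by
  intro x hx hx0
  have hloc : ∀ u, G.localRestrict u x ∈ C u := by
    simpa [SimpleGraph.graphCode, Submodule.mem_iInf] using hx
  obtain ⟨⟨e, he⟩, hxe⟩ := Function.ne_iff.mp hx0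
  induction e with | _ a b => ?_
  have : Nonempty V := ⟨a⟩
  let S : Finset V := {v | G.localRestrict v x ≠ 0}
  have hS : ∀ v, v ∈ S ↔ G.localRestrict v x ≠ 0 := by simp [S]
  have haS : a ∈ S := (hS a).2 fun h0 => hxe (congrFun h0 ⟨b, he⟩)
  have hk : (0 : ℝ) < #S := by exact_mod_cast Finset.card_pos.2 ⟨a, haS⟩
  have hn : (0 : ℝ) < Fintype.card V := by exact_mod_cast Fintype.card_pos
  have hkn : (#S : ℝ) ≤ Fintype.card V := by exact_mod_cast Finset.card_le_univ S
  have hd : (0 : ℝ) < d := hlam0.trans_lt hlamd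
  have hdeg : ∀ u ∈ S, δ * d ≤ (hammingNorm (G.localRestrict u x) : ℝ) := fun u hu =>
    hdist u _ (hloc u) ((hS u).1 hu)
  have hE : 2 * (G.edgeFinset.card : ℝ) = Fintype.card V * d := by
    have h := G.sum_degrees_eq_twice_card_edges
    simp only [hreg.degree_eq, Finset.sum_const, Finset.card_univ, smul_eq_mul] at h
    exact_mod_cast h.symm
  have hweight : #S * (δ * d) ≤ 2 * (hammingNorm x : ℝ) := by
    have h : (∑ u, (hammingNorm (G.localRestrict u x) : ℝ)) = 2 * hammingNorm x := by
      exact_mod_cast G.sum_hammingNorm_localRestrict x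
    rw [← h, ← nsmul_eq_mul, ← Finset.sum_const]
    exact (Finset.sum_le_sum hdeg).trans
      (Finset.sum_le_sum_of_subset_of_nonneg (Finset.subset_univ _) fun _ _ _ => by positivity)
  have hmix := G.card_mul_sum_card_filter_neighborFinset_le hreg hspec S
  have hlower : #S * (δ * d) ≤ ∑ u ∈ S, (#{v ∈ G.neighborFinset u | v ∈ S} : ℝ) := by
    rw [← nsmul_eq_mul, ← Finset.sum_const]
    refine Finset.sum_le_sum fun u hu => (hdeg u hu).trans ?_
    simp only [hS]
    exact_mod_cast G.hammingNorm_localRestrict_le x u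
  set n : ℝ := (Fintype.card V : ℝ)
  set k : ℝ := (#S : ℝ)
  have hkey : n * (δ * d) ≤ d * k + lam * (n - k) := by
    refine le_of_mul_le_mul_left ?_ hk
    have := mul_le_mul_of_nonneg_left hlower hn.le
    linarith
  have hδ0 : 0 < δ * d - lam := by rw [div_lt_iff₀ hd] at hδ; linarith
  have hdl : 0 < d - lam := sub_pos.2 hlamd
  have hγ : (δ - lam / d) / (1 - lam / d) = (δ * d - lam) / (d - lam) := by
    rw [← mul_div_mul_right _ _ hd.ne']
    congr 1 <;> field_simp
  rw [hγ]
  set γ := (δ * d - lam) / (d - lam) with hγ_def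
  have hγ0 : 0 < γ := div_pos hδ0 hdl
  have hγk : γ * n ≤ k := by
    rw [hγ_def, div_mul_eq_mul_div, div_le_iff₀ hdl]
    linarith
  have hδ1 : δ ≤ 1 := by
    refine le_of_mul_le_mul_right (le_of_mul_le_mul_left (?_ : n * (δ * d) ≤ n * (1 * d)) hn) hd
    nlinarith [mul_nonneg (sub_nonneg.2 hkn) hdl.le]
  have hγδ : γ ≤ δ := by
    rw [hγ_def, div_le_iff₀ hdl]
    nlinarith [mul_nonneg (sub_nonneg.2 hδ1) hlam0]
  have hprod : γ * (γ * n) ≤ δ * k := mul_le_mul hγδ hγk (by positivity) (hγ0.le.trans hγδ)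
  have := mul_le_mul_of_nonneg_right hprod hd.le
  calc γ ^ 2 * (G.edgeFinset.card : ℝ) = γ * (γ * n) * d / 2 := by
        linear_combination γ ^ 2 / 2 * hE
    _ ≤ hammingNorm x := by linarith
end

section
/- Let n ≥ 2 be a fixed integer. For every integer K > 0 there exists λ = λ(n,K) > 0 such that for all sufficiently large N (with K·C(N,n) an admissible face count) there exists a family X of (n+1)-element subsets of {1,…,N} with |X| = K·C(N,n) having the following property: for every nonzero F_2-valued function z : X → F_2 in the kernel of the boundary map ∂_n (i.e., for every n-element subset τ of {1,…,N}, the number of σ ∈ X with z(σ)=1 and τ ⊂ σ is even), the support of z has size at least λ·C(N,n). Here C(N,n) denotes the binomial coefficient. In other words, the homological code H_n(X;F_2) ⊆ F_2^{|X|} has distance at least λ·C(N,n), hence relative distance δ ≥ λ/K. -/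
open Finset

namespace HomologicalCode

section DeletionMethod

variable {α ι : Type*} [DecidableEq α]

/-- The random subset of `F` containing each element independently with probability `p`
contains a given `B ⊆ F` with probability `p ^ #B`. -/
theorem sum_powerset_superset_weight {F B : Finset α} (hB : B ⊆ F) (p : ℝ) :
    ∑ X ∈ F.powerset, (if B ⊆ X then p ^ #X * (1 - p) ^ #(F \ X) else 0) = p ^ #B := by
  have key := Finset.prod_add (fun _ : α => p) (fun i => if i ∈ B then 0 else 1 - p) F
  have hl : ∏ i ∈ F, (p + if i ∈ B then 0 else 1 - p) = p ^ #B := by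
    have : ∀ i ∈ F, (p + if i ∈ B then 0 else 1 - p) = if i ∈ B then p else 1 := by
      intro i _
      split_ifs <;> ring
    rw [prod_congr rfl this, prod_ite_mem, inter_eq_right.2 hB, prod_const]
  rw [← hl, key]
  refine sum_congr rfl fun X hX => ?_
  rw [prod_const]
  split_ifs with h
  · congr 1
    rw [← prod_const]
    refine prod_congr rfl fun i hi => ?_
    rw [if_neg fun hb => (mem_sdiff.1 hi).2 (h hb)]
  · obtain ⟨i, hiB, hiX⟩ := not_subset.1 h
    rw [prod_eq_zero (i := i) (mem_sdiff.2 ⟨hB hiB, hiX⟩) (by simp [hiB]), mul_zero]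

theorem exists_subset_avoiding (F : Finset α) (I : Finset ι) (B : ι → Finset α)
    (hB : ∀ i ∈ I, B i ⊆ F ∧ (B i).Nonempty) {p : ℝ} (hp0 : 0 < p) (hp1 : p < 1) :
    ∃ Y ⊆ F, (∀ i ∈ I, ¬ B i ⊆ Y) ∧ p * #F - ∑ i ∈ I, p ^ #(B i) ≤ #Y := by
  classical
  rcases I.eq_empty_or_nonempty with rfl | ⟨i₀, hi₀⟩
  · refine ⟨F, Subset.rfl, by simp, ?_⟩
    simpa using mul_le_of_le_one_left (Nat.cast_nonneg (α := ℝ) #F) hp1.le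
  have : Nonempty α := ⟨(hB i₀ hi₀).2.choose⟩
  set w : Finset α → ℝ := fun X => p ^ #X * (1 - p) ^ #(F \ X) with hw
  have hwpos : ∀ X, 0 < w X := fun X => mul_pos (pow_pos hp0 _) (pow_pos (by linarith) _)
  have htot : ∑ X ∈ F.powerset, w X = 1 := by
    simpa using sum_powerset_superset_weight (empty_subset F) p
  have hcard : ∑ X ∈ F.powerset, w X * #X = p * #F := by
    have h1 : ∀ X ∈ F.powerset, w X * #X = ∑ x ∈ F, if {x} ⊆ X then w X else 0 := by
      intro X hX
      simp only [singleton_subset_iff]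
      rw [sum_ite_mem, inter_eq_right.2 (mem_powerset.1 hX), sum_const, nsmul_eq_mul, mul_comm]
    rw [sum_congr rfl h1, sum_comm, sum_congr rfl fun x hx =>
      sum_powerset_superset_weight (singleton_subset_iff.2 hx) p]
    simp [mul_comm]
  have hbad : ∑ X ∈ F.powerset, w X * #{i ∈ I | B i ⊆ X} = ∑ i ∈ I, p ^ #(B i) := by
    have h1 : ∀ X ∈ F.powerset, w X * #{i ∈ I | B i ⊆ X} =
        ∑ i ∈ I, if B i ⊆ X then w X else 0 := by
      intro X _
      rw [← sum_filter, sum_const, nsmul_eq_mul, mul_comm]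
    rw [sum_congr rfl h1, sum_comm]
    exact sum_congr rfl fun i hi => sum_powerset_superset_weight (hB i hi).1 p
  obtain ⟨X, hXF, hX⟩ : ∃ X ∈ F.powerset, w X * (p * #F - ∑ i ∈ I, p ^ #(B i)) ≤
      w X * (#X - #{i ∈ I | B i ⊆ X}) := by
    refine exists_le_of_sum_le ⟨∅, empty_mem_powerset _⟩ (le_of_eq ?_)
    rw [← sum_mul, htot, one_mul]
    simp only [mul_sub]
    rw [sum_sub_distrib, hcard, hbad]
  have hX' := le_of_mul_le_mul_left hX (hwpos X)
  choose! f hf using fun i hi => (hB i hi).2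
  refine ⟨X \ {i ∈ I | B i ⊆ X}.image f, sdiff_subset.trans (mem_powerset.1 hXF), ?_, ?_⟩
  · intro i hi hsub
    have := mem_sdiff.1 (hsub (hf i hi))
    exact this.2 (mem_image_of_mem f (mem_filter.2 ⟨hi, hsub.trans sdiff_subset⟩))
  · have h1 := le_card_sdiff ({i ∈ I | B i ⊆ X}.image f) X
    have h2 : #({i ∈ I | B i ⊆ X}.image f) ≤ #{i ∈ I | B i ⊆ X} := card_image_le
    have h3 : #X ≤ #(X \ {i ∈ I | B i ⊆ X}.image f) + #{i ∈ I | B i ⊆ X} := by omega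
    have h4 : (#X : ℝ) ≤ #(X \ {i ∈ I | B i ⊆ X}.image f) + #{i ∈ I | B i ⊆ X} := by
      exact_mod_cast h3
    linarith

end DeletionMethod

section Cycles

variable {V : Type*} [DecidableEq V]

/-- The number of faces in `Z` containing `τ`. -/
def codegree (Z : Finset (Finset V)) (τ : Finset V) : ℕ := #{σ ∈ Z | τ ⊆ σ}

/-- The family `Z` covers every `k`-set an even number of times. -/
def IsEvenCover (k : ℕ) (Z : Finset (Finset V)) : Prop :=
  ∀ τ : Finset V, #τ = k → Even (codegree Z τ)

/-- Progress measure on a set `O` of edges, relative to a set `H` of heavy vertices: the number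
of edges avoiding `H`, plus one if some edge is not contained in `H`. -/
def potential (H : Finset V) (O : Finset (Finset V)) : ℕ :=
  #{e ∈ O | Disjoint e H} + if ∃ e ∈ O, ¬ e ⊆ H then 1 else 0

theorem codegree_insert {S : Finset (Finset V)} {σ : Finset V} (hσ : σ ∉ S) (τ : Finset V) :
    codegree (insert σ S) τ = codegree S τ + if τ ⊆ σ then 1 else 0 := by
  unfold codegree
  rw [filter_insert]
  split_ifs with h
  · rw [card_insert_of_notMem (by simp [hσ])]
  · simp

theorem potential_le_symmDiff_add_four (H : Finset V) (O : Finset (Finset V)) {σ : Finset V}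
    (hσ : #σ = 3) :
    potential H O ≤ potential H (symmDiff O (powersetCard 2 σ)) + 4 := by
  unfold potential
  have h1 : #{e ∈ O | Disjoint e H} ≤
      #{e ∈ symmDiff O (powersetCard 2 σ) | Disjoint e H} + #(powersetCard 2 σ) := by
    rw [← Nat.sub_le_iff_le_add]
    refine (le_card_sdiff _ _).trans (card_le_card fun e he => ?_)
    simp only [mem_sdiff, mem_filter, mem_symmDiff] at he ⊢
    tauto
  have h2 : #(powersetCard 2 σ) = 3 := by rw [card_powersetCard, hσ]; rfl
  split_ifs <;> omega

/-- An odd edge with as few heavy vertices as possible. -/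
theorem exists_mem_fewest_heavy (H : Finset V) {O : Finset (Finset V)} (hO : O.Nonempty) :
    ∃ τ ∈ O, Disjoint τ H ∨ ((∀ e ∈ O, ¬ Disjoint e H) ∧ (¬ τ ⊆ H ∨ ∀ e ∈ O, e ⊆ H)) := by
  by_cases h1 : ∃ τ ∈ O, Disjoint τ H
  · obtain ⟨τ, hτ, h⟩ := h1
    exact ⟨τ, hτ, Or.inl h⟩
  push Not at h1
  by_cases h2 : ∃ τ ∈ O, ¬ τ ⊆ H
  · obtain ⟨τ, hτ, h⟩ := h2
    exact ⟨τ, hτ, Or.inr ⟨h1, Or.inl h⟩⟩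
  push Not at h2
  obtain ⟨τ, hτ⟩ := hO
  exact ⟨τ, hτ, Or.inr ⟨h1, Or.inr h2⟩⟩

theorem potential_add_one_le_symmDiff (H : Finset V) {O : Finset (Finset V)} {τ : Finset V}
    (hτ : τ ∈ O) (hτ2 : #τ = 2)
    (hmax : Disjoint τ H ∨ ((∀ e ∈ O, ¬ Disjoint e H) ∧ (¬ τ ⊆ H ∨ ∀ e ∈ O, e ⊆ H)))
    {v : V} (hvτ : v ∉ τ) (hvH : v ∉ H) (hnew : ∀ u ∈ τ, u ∉ H → {u, v} ∉ O) :
    potential H O + 1 ≤ potential H (symmDiff O (powersetCard 2 (insert v τ))) := by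
  have hmem : ∀ u ∈ τ, {u, v} ∉ O → {u, v} ∈ symmDiff O (powersetCard 2 (insert v τ)) := by
    intro u hu h
    refine mem_symmDiff.2 (Or.inr ⟨mem_powersetCard.2 ⟨?_, card_pair ?_⟩, h⟩)
    · intro x hx
      rcases mem_insert.1 hx with rfl | hx
      · exact mem_insert_of_mem hu
      · rw [mem_singleton.1 hx]; exact mem_insert_self _ _
    · rintro rfl; exact hvτ hu
  have hind : ∀ u ∈ τ, {u, v} ∉ O →
      ∃ e ∈ symmDiff O (powersetCard 2 (insert v τ)), ¬ e ⊆ H := fun u hu h =>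
    ⟨_, hmem u hu h, fun hs => hvH (hs (by simp))⟩
  have hdisj : ∀ u, u ∉ H → Disjoint {u, v} H := by
    intro u hu
    simp [hu, hvH]
  rcases hmax with hd | ⟨hnone, hl | hall⟩
  · obtain ⟨x, y, hxy, rfl⟩ := card_eq_two.1 hτ2
    have hx : x ∉ H := disjoint_left.1 hd (by simp)
    have hy : y ∉ H := disjoint_left.1 hd (by simp)
    have hxv := hnew x (by simp) hx
    have hyv := hnew y (by simp) hy
    have hne : ({x, v} : Finset V) ≠ {y, v} := by
      intro h
      have : x ∈ ({y, v} : Finset V) := h ▸ (by simp)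
      simp only [mem_insert, mem_singleton] at this hvτ
      rcases this with h | h
      · exact hxy h
      · exact hvτ (Or.inl h.symm)
    have hsub : insert {x, v} (insert {y, v} ({e ∈ O | Disjoint e H}.erase {x, y})) ⊆
        {e ∈ symmDiff O (powersetCard 2 (insert v {x, y})) | Disjoint e H} := by
      intro e he
      simp only [mem_insert, mem_erase] at he
      rcases he with rfl | rfl | ⟨hne', he⟩
      · exact mem_filter.2 ⟨hmem x (by simp) hxv, hdisj x hx⟩
      · exact mem_filter.2 ⟨hmem y (by simp) hyv, hdisj y hy⟩
      · obtain ⟨heO, hed⟩ := mem_filter.1 he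
        refine mem_filter.2 ⟨mem_symmDiff.2 (Or.inl ⟨heO, fun hP => ?_⟩), hed⟩
        obtain ⟨hes, he2⟩ := mem_powersetCard.1 hP
        by_cases hve : v ∈ e
        · obtain ⟨u, hu, huv⟩ := exists_mem_ne (by omega : 1 < #e) v
          have heq : e = {u, v} := by
            symm
            refine eq_of_subset_of_card_le ?_ (by rw [card_pair huv, he2])
            simp [insert_subset_iff, hu, hve]
          have hu' := mem_insert.1 (hes hu)
          simp only [mem_insert, mem_singleton] at hu'
          rcases hu' with h | h | h
          · exact huv h
          · subst h; exact hxv (heq ▸ heO)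
          · subst h; exact hyv (heq ▸ heO)
        · refine hne' (eq_of_subset_of_card_le ?_ (by rw [he2, hτ2]))
          intro z hz
          rcases mem_insert.1 (hes hz) with rfl | h
          · exact absurd hz hve
          · exact h
    have hc := card_le_card hsub
    rw [card_insert_of_notMem, card_insert_of_notMem, card_erase_of_mem] at hc
    · have hpos : 0 < #{e ∈ O | Disjoint e H} := card_pos.2 ⟨_, mem_filter.2 ⟨hτ, hd⟩⟩
      unfold potential
      rw [if_pos (hind x (by simp) hxv)]
      split_ifs <;> omega
    · exact mem_filter.2 ⟨hτ, hd⟩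
    · simp [hyv]
    · simp [hxv, hne]
  · obtain ⟨x, hx, hxH⟩ := not_subset.1 hl
    have hxv := hnew x hx hxH
    have h0 : #{e ∈ O | Disjoint e H} = 0 := by
      rw [card_eq_zero, filter_eq_empty_iff]; exact fun e he => hnone e he
    have h1 : 0 < #{e ∈ symmDiff O (powersetCard 2 (insert v τ)) | Disjoint e H} :=
      card_pos.2 ⟨_, mem_filter.2 ⟨hmem x hx hxv, hdisj x hxH⟩⟩
    unfold potential
    rw [if_pos (hind x hx hxv)]
    split_ifs <;> omega
  · obtain ⟨x, hx⟩ := card_pos.1 (by omega : 0 < #τ)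
    have h0 : #{e ∈ O | Disjoint e H} = 0 := by
      rw [card_eq_zero, filter_eq_empty_iff]; exact fun e he => hnone e he
    have hxv : {x, v} ∉ O := fun h => hvH (hall _ h (by simp))
    unfold potential
    rw [if_pos (hind x hx hxv), if_neg (by push Not; exact hall)]
    omega

theorem two_le_card_of_isEvenCover {Z : Finset (Finset V)} (hZ : Z.Nonempty)
    (hcard : ∀ σ ∈ Z, #σ = 3) (heven : IsEvenCover 2 Z) : 2 ≤ #Z := by
  obtain ⟨σ, hσ⟩ := hZ
  obtain ⟨τ, hτσ, hτ⟩ := exists_subset_card_eq (by rw [hcard σ hσ]; norm_num : 2 ≤ #σ)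
  have hpos : 0 < codegree Z τ := card_pos.2 ⟨σ, mem_filter.2 ⟨hσ, hτσ⟩⟩
  obtain ⟨r, hr⟩ := heven τ hτ
  have : codegree Z τ ≤ #Z := card_filter_le _ _
  omega

theorem sum_codegree_insert_le {m : ℕ} {Z : Finset (Finset V)} (hZ : ∀ σ ∈ Z, #σ ≤ m)
    (A U : Finset V) : ∑ u ∈ U, codegree Z (insert u A) ≤ m * codegree Z A := by
  have h1 : ∀ u ∈ U, codegree Z (insert u A) =
      ∑ σ ∈ Z with A ⊆ σ, if u ∈ σ then 1 else 0 := by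
    intro u _
    rw [codegree, ← card_filter, filter_filter]
    congr 1
    ext σ
    simp [insert_subset_iff, and_comm]
  rw [sum_congr rfl h1, sum_comm, codegree, mul_comm]
  refine (sum_le_card_nsmul _ _ m fun σ hσ => ?_).trans (by rw [smul_eq_mul])
  rw [sum_boole, Nat.cast_id, filter_mem_eq_inter]
  exact (card_le_card inter_subset_right).trans (hZ σ (mem_filter.1 hσ).1)

variable [Fintype V]

/-- The edges covered an odd number of times by `S`, i.e. the support of its boundary. -/
def oddEdges (S : Finset (Finset V)) : Finset (Finset V) :=
  {e ∈ powersetCard 2 univ | Odd (codegree S e)}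

/-- The vertices sharing a face of `Z` with `u`. -/
def neighbors (Z : Finset (Finset V)) (u : V) : Finset V :=
  {v | v ≠ u ∧ ∃ σ ∈ Z, u ∈ σ ∧ v ∈ σ}

theorem oddEdges_insert {S : Finset (Finset V)} {σ : Finset V} (hσ : σ ∉ S) :
    oddEdges (insert σ S) = symmDiff (oddEdges S) (powersetCard 2 σ) := by
  ext e
  simp only [oddEdges, mem_symmDiff, mem_filter, mem_powersetCard, subset_univ, true_and,
    codegree_insert hσ]
  by_cases h : e ⊆ σ <;> by_cases h2 : #e = 2 <;> simp [h, h2, Nat.odd_add_one]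

theorem isEvenCover_iff_oddEdges_eq_empty {S : Finset (Finset V)} :
    IsEvenCover 2 S ↔ oddEdges S = ∅ := by
  simp [IsEvenCover, oddEdges, filter_eq_empty_iff]

theorem neighbors_mono {S Z : Finset (Finset V)} (h : S ⊆ Z) (u : V) :
    neighbors S u ⊆ neighbors Z u := by
  intro v hv
  simp only [neighbors, mem_filter, mem_univ, true_and] at hv ⊢
  obtain ⟨hne, σ, hσ, h'⟩ := hv
  exact ⟨hne, σ, h hσ, h'⟩

theorem mem_neighbors_of_mem_oddEdges {S : Finset (Finset V)} {u v : V} (hne : v ≠ u)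
    (h : {u, v} ∈ oddEdges S) : v ∈ neighbors S u := by
  have hpos := (mem_filter.1 h).2.pos
  obtain ⟨σ, hσ⟩ := card_pos.1 hpos
  obtain ⟨hσS, hs⟩ := mem_filter.1 hσ
  simp only [neighbors, mem_filter, mem_univ, true_and]
  exact ⟨hne, σ, hσS, hs (by simp), hs (by simp)⟩

/-- If `S` covers `τ` an odd number of times, then every cycle `Z ⊇ S` has a further triangle
over `τ`. -/
theorem exists_insert_subset {S Z : Finset (Finset V)} {τ : Finset V} (hSZ : S ⊆ Z)
    (hcard : ∀ σ ∈ Z, #σ = 3) (heven : IsEvenCover 2 Z) (hτ : τ ∈ oddEdges S) :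
    ∃ v, v ∉ τ ∧ insert v τ ∉ S ∧ insert (insert v τ) S ⊆ Z := by
  simp only [oddEdges, mem_filter, mem_powersetCard, subset_univ, true_and] at hτ
  have hlt : codegree S τ < codegree Z τ := by
    refine lt_of_le_of_ne (card_le_card (filter_subset_filter _ hSZ)) fun h => ?_
    exact (Nat.not_even_iff_odd.2 hτ.2) (h ▸ heven τ hτ.1)
  obtain ⟨σ, hσZ, hσS⟩ := exists_mem_notMem_of_card_lt_card hlt
  obtain ⟨hσZ, hτσ⟩ := mem_filter.1 hσZ
  have hσS' : σ ∉ S := fun h => hσS (mem_filter.2 ⟨h, hτσ⟩)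
  obtain ⟨v, hv, rfl⟩ : ∃ v, v ∉ τ ∧ insert v τ = σ := by
    have h1 : #(σ \ τ) = 1 := by rw [card_sdiff_of_subset hτσ, hcard σ hσZ, hτ.1]
    obtain ⟨v, hv⟩ := card_eq_one.1 h1
    refine ⟨v, (mem_sdiff.1 (hv ▸ mem_singleton_self v : v ∈ σ \ τ)).2, ?_⟩
    rw [insert_eq, ← hv, sdiff_union_of_subset hτσ]
  exact ⟨v, hv, hσS', insert_subset hσZ hSZ⟩

/-- Minimal cycles containing `S` whose high-degree vertices lie in `H`, enumerated by repeatedly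
adding a triangle over a well-chosen odd edge. -/
theorem sum_pow_card_sdiff_le (H : Finset V) (𝓕 : Finset (Finset (Finset V)))
    (hcard : ∀ Z ∈ 𝓕, ∀ σ ∈ Z, #σ = 3) (heven : ∀ Z ∈ 𝓕, IsEvenCover 2 Z)
    (hmin : ∀ Z ∈ 𝓕, ∀ S ⊆ Z, S.Nonempty → IsEvenCover 2 S → S = Z)
    {t b q : ℝ} (hnb : ∀ Z ∈ 𝓕, ∀ u ∉ H, (#(neighbors Z u) : ℝ) ≤ t) (hH : (#H : ℝ) ≤ t)
    (hq : 0 ≤ q) (hb : 1 ≤ b) (hstep : q * (3 * t * b ^ 4 + Fintype.card V * b⁻¹) ≤ 1)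
    (S : Finset (Finset V)) (hS : S.Nonempty) :
    ∑ Z ∈ 𝓕 with S ⊆ Z, q ^ #(Z \ S) ≤ (b ^ potential H (oddEdges S))⁻¹ := by
  have hb0 : 0 < b := by linarith
  induction S using WellFoundedGT.induction with
  | _ S ih =>
  rcases ({Z ∈ 𝓕 | S ⊆ Z}).eq_empty_or_nonempty with h0 | ⟨Z₀, hZ₀⟩
  · rw [h0, sum_empty]; positivity
  obtain ⟨hZ₀, hSZ₀⟩ := mem_filter.1 hZ₀
  rcases (oddEdges S).eq_empty_or_nonempty with hO | hO
  · have hev := isEvenCover_iff_oddEdges_eq_empty.2 hO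
    have hsub : {Z ∈ 𝓕 | S ⊆ Z} ⊆ {S} := fun Z hZ => by
      obtain ⟨hZ, hSZ⟩ := mem_filter.1 hZ
      rw [mem_singleton, hmin Z hZ S hSZ hS hev]
    refine (sum_le_sum_of_subset_of_nonneg hsub fun _ _ _ => by positivity).trans ?_
    simp [hO, potential]
  obtain ⟨τ, hτ, hmax⟩ := exists_mem_fewest_heavy H hO
  have hτ2 : #τ = 2 := (mem_powersetCard.1 (mem_filter.1 hτ).1).2
  set A : Finset V := {v | v ∉ τ ∧ insert v τ ∉ S} with hA
  set C : Finset V := H ∪ {u ∈ τ | u ∉ H}.biUnion (neighbors S) with hC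
  set P := potential H (oddEdges S) with hP
  have hCcard : (#C : ℝ) ≤ 3 * t := by
    have h1 : (#C : ℝ) ≤ #H + ∑ u ∈ τ with u ∉ H, (#(neighbors S u) : ℝ) := by
      exact_mod_cast (card_union_le _ _).trans (Nat.add_le_add_left card_biUnion_le _)
    have h2 : ∑ u ∈ τ with u ∉ H, (#(neighbors S u) : ℝ) ≤ ∑ u ∈ τ with u ∉ H, t :=
      sum_le_sum fun u hu => le_trans
        (by exact_mod_cast card_le_card (neighbors_mono hSZ₀ u)) (hnb Z₀ hZ₀ u (mem_filter.1 hu).2)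
    have h3 : (#{u ∈ τ | u ∉ H} : ℝ) ≤ 2 := by
      exact_mod_cast (card_filter_le _ _).trans hτ2.le
    have ht : 0 ≤ t := le_trans (Nat.cast_nonneg _) hH
    rw [sum_const, nsmul_eq_mul] at h2
    nlinarith
  have hrec : ∑ Z ∈ 𝓕 with S ⊆ Z, q ^ #(Z \ S) ≤
      ∑ v ∈ A, q * ∑ Z ∈ 𝓕 with insert (insert v τ) S ⊆ Z, q ^ #(Z \ insert (insert v τ) S) := by
    have hterm : ∀ v ∈ A,
        q * ∑ Z ∈ 𝓕 with insert (insert v τ) S ⊆ Z, q ^ #(Z \ insert (insert v τ) S) =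
        ∑ Z ∈ 𝓕, if insert (insert v τ) S ⊆ Z then q ^ #(Z \ S) else 0 := by
      intro v hv
      rw [mul_sum, sum_filter]
      refine sum_congr rfl fun Z _ => ?_
      split_ifs with h
      · have hvS := (mem_filter.1 hv).2.2
        have : Z \ S = insert (insert v τ) (Z \ insert (insert v τ) S) := by
          rw [← erase_eq_iff_eq_insert]
          · rw [sdiff_insert]
          · exact mem_sdiff.2 ⟨h (mem_insert_self _ _), hvS⟩
          · simp
        rw [this, card_insert_of_notMem (by simp), pow_succ, mul_comm]
      · rfl
    rw [sum_congr rfl hterm, sum_comm, sum_filter]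
    refine sum_le_sum fun Z hZ => ?_
    have hnn : ∀ v ∈ A, 0 ≤ if insert (insert v τ) S ⊆ Z then q ^ #(Z \ S) else 0 :=
      fun v _ => by split_ifs <;> positivity
    split_ifs with h
    · obtain ⟨v, hv, hvS, hvZ⟩ := exists_insert_subset h (hcard Z hZ) (heven Z hZ) hτ
      refine le_trans (le_of_eq ?_) (single_le_sum hnn (by simp [hA, hv, hvS] : v ∈ A))
      rw [if_pos hvZ]
    · exact sum_nonneg hnn
  have hbound : ∀ v ∈ A,
      ∑ Z ∈ 𝓕 with insert (insert v τ) S ⊆ Z, q ^ #(Z \ insert (insert v τ) S) ≤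
      (b ^ P)⁻¹ * ((if v ∈ C then b ^ 4 else 0) + b⁻¹) := by
    intro v hv
    obtain ⟨hvτ, hvS⟩ := (mem_filter.1 hv).2
    refine (ih _ (ssubset_insert hvS) (insert_nonempty _ _)).trans ?_
    rw [oddEdges_insert hvS]
    split_ifs with hvC
    · have h4 := potential_le_symmDiff_add_four H (oddEdges S) (σ := insert v τ)
        (by rw [card_insert_of_notMem hvτ, hτ2])
      refine le_trans ?_ (mul_le_mul_of_nonneg_left
        (le_add_of_nonneg_right (by positivity : 0 ≤ b⁻¹)) (by positivity))
      rw [inv_mul_eq_div, inv_eq_one_div, div_le_div_iff₀ (by positivity) (by positivity), one_mul,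
        ← pow_add, add_comm]
      exact pow_le_pow_right₀ hb (by omega)
    · rw [zero_add, ← mul_inv, ← pow_succ]
      refine inv_anti₀ (by positivity) (pow_le_pow_right₀ hb ?_)
      simp only [hC, mem_union, mem_biUnion, mem_filter, not_or, not_exists, not_and] at hvC
      refine potential_add_one_le_symmDiff H hτ hτ2 hmax hvτ hvC.1 fun u hu huH huv => ?_
      exact hvC.2 u ⟨hu, huH⟩ (mem_neighbors_of_mem_oddEdges (by rintro rfl; exact hvτ hu) huv)
  calc _ ≤ _ := hrec
    _ ≤ ∑ v ∈ A, q * ((b ^ P)⁻¹ * ((if v ∈ C then b ^ 4 else 0) + b⁻¹)) :=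
        sum_le_sum fun v hv => mul_le_mul_of_nonneg_left (hbound v hv) hq
    _ ≤ ∑ v, q * ((b ^ P)⁻¹ * ((if v ∈ C then b ^ 4 else 0) + b⁻¹)) :=
        sum_le_sum_of_subset_of_nonneg (subset_univ _) fun v _ _ => by
          split_ifs <;> positivity
    _ = (b ^ P)⁻¹ * (q * (#C * b ^ 4 + Fintype.card V * b⁻¹)) := by
        rw [← mul_sum, ← mul_sum, sum_add_distrib, sum_ite_mem, univ_inter, sum_const, sum_const,
          card_univ, nsmul_eq_mul, nsmul_eq_mul]
        ring
    _ ≤ (b ^ P)⁻¹ * 1 := by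
        refine mul_le_mul_of_nonneg_left (le_trans ?_ hstep) (by positivity)
        gcongr
    _ = (b ^ P)⁻¹ := mul_one _

theorem sum_card_neighbors_le {Z : Finset (Finset V)} (hcard : ∀ σ ∈ Z, #σ = 3) :
    ∑ u, #(neighbors Z u) ≤ 6 * #Z := by
  have h1 : ∀ u, #(neighbors Z u) ≤ ∑ σ ∈ Z, if u ∈ σ then 2 else 0 := by
    intro u
    have hsub : neighbors Z u ⊆ {σ ∈ Z | u ∈ σ}.biUnion fun σ => σ.erase u := by
      intro v hv
      simp only [neighbors, mem_filter, mem_univ, true_and] at hv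
      obtain ⟨hne, σ, hσ, hu, hv⟩ := hv
      exact mem_biUnion.2 ⟨σ, mem_filter.2 ⟨hσ, hu⟩, mem_erase.2 ⟨hne, hv⟩⟩
    refine (card_le_card hsub).trans (card_biUnion_le.trans ?_)
    rw [← sum_filter]
    refine sum_le_sum fun σ hσ => ?_
    obtain ⟨hσ, hu⟩ := mem_filter.1 hσ
    rw [card_erase_of_mem hu, hcard σ hσ]
  refine (sum_le_sum fun u _ => h1 u).trans ?_
  rw [sum_comm]
  have h2 : ∀ σ ∈ Z, (∑ u, if u ∈ σ then 2 else 0) = 6 := by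
    intro σ hσ
    rw [sum_ite_mem, univ_inter, sum_const, hcard σ hσ]; rfl
  rw [sum_congr rfl h2, sum_const, smul_eq_mul, mul_comm]

open Classical in
/-- Minimal nonempty cycles of triangles with at most `M` ordered pairs of adjacent vertices. -/
noncomputable def smallCycles (V : Type*) [Fintype V] [DecidableEq V] (M : ℝ) :
    Finset (Finset (Finset V)) :=
  {Z | Z.Nonempty ∧ (∀ σ ∈ Z, #σ = 3) ∧ IsEvenCover 2 Z ∧
    (∀ S ⊆ Z, S.Nonempty → IsEvenCover 2 S → S = Z) ∧ (∑ u, #(neighbors Z u) : ℝ) ≤ M}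

theorem mem_smallCycles {M : ℝ} {Z : Finset (Finset V)} :
    Z ∈ smallCycles V M ↔ Z.Nonempty ∧ (∀ σ ∈ Z, #σ = 3) ∧ IsEvenCover 2 Z ∧
    (∀ S ⊆ Z, S.Nonempty → IsEvenCover 2 S → S = Z) ∧ (∑ u, #(neighbors Z u) : ℝ) ≤ M := by
  simp [smallCycles]

theorem sum_pow_card_le (H : Finset V) (𝓕 : Finset (Finset (Finset V)))
    (hne : ∀ Z ∈ 𝓕, Z.Nonempty)
    (hcard : ∀ Z ∈ 𝓕, ∀ σ ∈ Z, #σ = 3) (heven : ∀ Z ∈ 𝓕, IsEvenCover 2 Z)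
    (hmin : ∀ Z ∈ 𝓕, ∀ S ⊆ Z, S.Nonempty → IsEvenCover 2 S → S = Z)
    {t b q : ℝ} (hnb : ∀ Z ∈ 𝓕, ∀ u ∉ H, (#(neighbors Z u) : ℝ) ≤ t) (hH : (#H : ℝ) ≤ t)
    (hq : 0 ≤ q) (hb : 1 ≤ b) (hstep : q * (3 * t * b ^ 4 + Fintype.card V * b⁻¹) ≤ 1) :
    ∑ Z ∈ 𝓕, q ^ #Z ≤ q * (Fintype.card V : ℝ) ^ 3 := by
  have h1 : ∀ Z ∈ 𝓕, q ^ #Z ≤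
      ∑ σ ∈ powersetCard 3 (univ : Finset V), if {σ} ⊆ Z then q * q ^ #(Z \ {σ}) else 0 := by
    intro Z hZ
    obtain ⟨σ, hσ⟩ := hne Z hZ
    refine le_trans (le_of_eq ?_) (single_le_sum (fun σ _ => by split_ifs <;> positivity)
      (mem_powersetCard.2 ⟨subset_univ σ, hcard Z hZ σ hσ⟩))
    rw [if_pos (singleton_subset_iff.2 hσ), ← pow_succ', card_sdiff_of_subset
      (singleton_subset_iff.2 hσ), card_singleton, Nat.sub_add_cancel (card_pos.2 ⟨σ, hσ⟩)]
  refine (sum_le_sum h1).trans ?_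
  rw [sum_comm]
  have h2 : ∀ σ ∈ powersetCard 3 (univ : Finset V),
      (∑ Z ∈ 𝓕, if {σ} ⊆ Z then q * q ^ #(Z \ {σ}) else 0) ≤ q := by
    intro σ _
    rw [← sum_filter, ← mul_sum]
    refine mul_le_of_le_one_right hq ((sum_pow_card_sdiff_le H 𝓕 hcard heven hmin hnb hH hq hb
      hstep {σ} (singleton_nonempty σ)).trans ?_)
    exact inv_le_one_of_one_le₀ (one_le_pow₀ hb)
  refine (sum_le_sum h2).trans ?_
  rw [sum_const, card_powersetCard, card_univ, nsmul_eq_mul, mul_comm]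
  exact mul_le_mul_of_nonneg_left (by exact_mod_cast Nat.choose_le_pow _ _) hq

theorem sum_smallCycles_le {t b q s M : ℝ} {k : ℕ} (hV : 0 < Fintype.card V) (ht : 0 < t)
    (hM : M ≤ t * t)
    (hq : 0 ≤ q) (hb : 1 ≤ b) (hstep : q * (3 * t * b ^ 4 + Fintype.card V * b⁻¹) ≤ 1)
    (hs0 : 0 < s) (hs1 : s ≤ 1) (hkt : 6 * k ≤ t) (hsk : s ^ k ≤ (Fintype.card V : ℝ)⁻¹) :
    ∑ Z ∈ smallCycles V M, (q * s ^ 3) ^ #Z ≤ 3 * s ^ 4 * q * (Fintype.card V : ℝ) ^ 3 := by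
  set N : ℝ := (Fintype.card V : ℝ) with hN
  have hN0 : 0 < N := Nat.cast_pos.2 hV
  set heavy : Finset (Finset V) → Finset V := fun Z => {u | t < #(neighbors Z u)} with hheavy
  have hheavy_card : ∀ Z, #(heavy Z) * t ≤ (∑ u, #(neighbors Z u) : ℝ) := by
    intro Z
    rw [← nsmul_eq_mul, ← sum_const]
    refine (sum_le_sum fun u hu => (mem_filter.1 hu).2.le).trans ?_
    exact sum_le_sum_of_subset_of_nonneg (subset_univ _) fun _ _ _ => Nat.cast_nonneg _
  have hterm : ∀ Z ∈ smallCycles V M, (q * s ^ 3) ^ #Z ≤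
      s ^ 4 * N⁻¹ ^ #(heavy Z) * q ^ #Z := by
    intro Z hZ
    obtain ⟨hne, hc, hev, -, -⟩ := mem_smallCycles.1 hZ
    have h2 := two_le_card_of_isEvenCover hne hc hev
    have h6 : (∑ u, #(neighbors Z u) : ℝ) ≤ 6 * #Z := by exact_mod_cast sum_card_neighbors_le hc
    have hk : k * #(heavy Z) ≤ #Z := by
      have h7 : (k * #(heavy Z) : ℝ) ≤ #Z := by
        nlinarith [hheavy_card Z, (Nat.cast_nonneg #(heavy Z) : (0 : ℝ) ≤ _)]
      exact_mod_cast h7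
    have h3 : s ^ #Z ≤ N⁻¹ ^ #(heavy Z) := calc
      s ^ #Z ≤ s ^ (k * #(heavy Z)) := pow_le_pow_of_le_one hs0.le hs1 hk
      _ = (s ^ k) ^ #(heavy Z) := pow_mul _ _ _
      _ ≤ _ := pow_le_pow_left₀ (by positivity) hsk _
    have h4 : s ^ (2 * #Z) ≤ s ^ 4 := pow_le_pow_of_le_one hs0.le hs1 (by omega)
    calc (q * s ^ 3) ^ #Z = s ^ (2 * #Z) * s ^ #Z * q ^ #Z := by ring
      _ ≤ s ^ 4 * N⁻¹ ^ #(heavy Z) * q ^ #Z := by gcongr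
  have hfib : ∀ H : Finset V, ∑ Z ∈ smallCycles V M with heavy Z = H, q ^ #Z ≤ q * N ^ 3 := by
    intro H
    rcases ({Z ∈ smallCycles V M | heavy Z = H}).eq_empty_or_nonempty with h0 | ⟨Z₀, hZ₀⟩
    · rw [h0, sum_empty]; positivity
    have hmem : ∀ Z ∈ {Z ∈ smallCycles V M | heavy Z = H}, _ := fun Z hZ =>
      mem_smallCycles.1 (mem_filter.1 hZ).1
    refine sum_pow_card_le H _ (fun Z hZ => (hmem Z hZ).1) (fun Z hZ => (hmem Z hZ).2.1)
      (fun Z hZ => (hmem Z hZ).2.2.1) (fun Z hZ => (hmem Z hZ).2.2.2.1) (t := t) ?_ ?_ hq hb hstep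
    · intro Z hZ u hu
      rw [← (mem_filter.1 hZ).2] at hu
      simpa [hheavy] using hu
    · rw [← (mem_filter.1 hZ₀).2]
      have := (hheavy_card Z₀).trans ((hmem Z₀ hZ₀).2.2.2.2.trans hM)
      exact le_of_mul_le_mul_right this ht
  calc ∑ Z ∈ smallCycles V M, (q * s ^ 3) ^ #Z
      ≤ ∑ Z ∈ smallCycles V M, s ^ 4 * N⁻¹ ^ #(heavy Z) * q ^ #Z := sum_le_sum hterm
    _ = ∑ H : Finset V, ∑ Z ∈ smallCycles V M with heavy Z = H,
          s ^ 4 * N⁻¹ ^ #(heavy Z) * q ^ #Z := (sum_fiberwise _ _ _).symm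
    _ = ∑ H : Finset V, s ^ 4 * N⁻¹ ^ #H * ∑ Z ∈ smallCycles V M with heavy Z = H, q ^ #Z := by
        refine sum_congr rfl fun H _ => ?_
        rw [mul_sum]
        exact sum_congr rfl fun Z hZ => by rw [(mem_filter.1 hZ).2]
    _ ≤ ∑ H : Finset V, s ^ 4 * N⁻¹ ^ #H * (q * N ^ 3) :=
        sum_le_sum fun H _ => mul_le_mul_of_nonneg_left (hfib H) (by positivity)
    _ = (N⁻¹ + 1) ^ Fintype.card V * (s ^ 4 * q * N ^ 3) := by
        rw [← card_univ, ← sum_pow_mul_eq_add_pow, powerset_univ, sum_mul]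
        refine sum_congr rfl fun H _ => ?_
        rw [one_pow]; ring
    _ ≤ 3 * (s ^ 4 * q * N ^ 3) := by
        refine mul_le_mul_of_nonneg_right ?_ (by positivity)
        calc (N⁻¹ + 1) ^ Fintype.card V ≤ Real.exp N⁻¹ ^ Fintype.card V :=
              pow_le_pow_left₀ (by positivity) (Real.add_one_le_exp _) _
          _ = Real.exp 1 := by rw [← Real.exp_nat_mul, ← hN, mul_inv_cancel₀ hN0.ne']
          _ ≤ 3 := by linarith [Real.exp_one_lt_d9]
    _ = _ := by ring

end Cycles

/-- In the binomial random family of triangles of density `c / N`, small cycles are rare. -/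
theorem exists_sum_smallCycles_le {c δ : ℝ} (hc : 0 < c) (hδ : 0 < δ) :
    ∃ lam : ℝ, 0 < lam ∧ ∃ N₀ : ℕ, ∀ N : ℕ, N₀ ≤ N →
      ∑ Z ∈ smallCycles (Fin N) (lam * N ^ 2), (c / N) ^ #Z ≤ δ * N ^ 2 := by
  set s : ℝ := min (1 / 2) (δ / (3 * c)) with hs
  have hs0 : 0 < s := lt_min (by norm_num) (by positivity)
  have hs1 : s < 1 := (min_le_left _ _).trans_lt (by norm_num)
  have hsδ : 3 * s * c ≤ δ := by
    have := min_le_right (1 / 2) (δ / (3 * c))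
    rw [← hs, le_div_iff₀ (by positivity)] at this
    linarith
  set d : ℝ := c / s ^ 3 with hd
  have hd0 : 0 < d := by positivity
  set b : ℝ := max 1 (2 * d) with hb
  have hb1 : 1 ≤ b := le_max_left _ _
  have hb0 : 0 < b := by linarith
  set ε : ℝ := 1 / (6 * d * b ^ 4) with hε
  have hε0 : 0 < ε := by positivity
  have hlim : Filter.Tendsto (fun N : ℕ => (⌊ε / 6 * N⌋₊ + 1 : ℝ) * s ^ ⌊ε / 6 * (N : ℝ)⌋₊)
      Filter.atTop (nhds 0) := by
    have h1 : Filter.Tendsto (fun k : ℕ => ((k : ℝ) + 1) * s ^ k) Filter.atTop (nhds 0) := by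
      have ha := tendsto_pow_const_mul_const_pow_of_abs_lt_one 1
        (by rwa [abs_of_pos hs0] : |s| < 1)
      have hb' := tendsto_pow_atTop_nhds_zero_of_lt_one hs0.le hs1
      simpa [add_mul] using ha.add hb'
    exact h1.comp (tendsto_nat_floor_atTop.comp
      (tendsto_natCast_atTop_atTop.const_mul_atTop (by positivity)))
  obtain ⟨N₀, hN₀⟩ := Filter.eventually_atTop.1
    (hlim.eventually_le_const (by positivity : (0 : ℝ) < ε / 6))
  refine ⟨ε ^ 2, by positivity, max N₀ 1, fun N hN => ?_⟩
  have hNpos : 0 < N := (le_max_right _ _).trans hN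
  have hN0 : (0 : ℝ) < N := by exact_mod_cast hNpos
  have hk := hN₀ N ((le_max_left _ _).trans hN)
  set k := ⌊ε / 6 * (N : ℝ)⌋₊ with hkdef
  have hk1 : (k : ℝ) ≤ ε / 6 * N := Nat.floor_le (by positivity)
  have hk2 : ε / 6 * N < k + 1 := Nat.lt_floor_add_one _
  have hsk : s ^ k ≤ (N : ℝ)⁻¹ := by
    rw [← one_div, le_div_iff₀ hN0]
    have hsk0 : 0 < s ^ k := by positivity
    have h1 : ε / 6 * (s ^ k * N) ≤ ε / 6 * 1 := by nlinarith
    exact le_of_mul_le_mul_left h1 (by positivity)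
  have hstep : d / N * (3 * (ε * N) * b ^ 4 + (Fintype.card (Fin N) : ℝ) * b⁻¹) ≤ 1 := by
    rw [Fintype.card_fin]
    have h1 : d / N * (3 * (ε * N) * b ^ 4 + N * b⁻¹) = 1 / 2 + d / b := by
      rw [hε]; field_simp; ring
    have h2 : d / b ≤ 1 / 2 := by
      rw [div_le_iff₀ hb0]
      have := le_max_right 1 (2 * d)
      linarith
    linarith
  have key := sum_smallCycles_le (V := Fin N) (t := ε * N) (b := b) (q := d / N) (s := s)
    (M := ε ^ 2 * N ^ 2) (k := k) (by simpa using hNpos) (by positivity) (le_of_eq (by ring))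
    (by positivity) hb1 hstep hs0 hs1.le (by linarith) (by simpa using hsk)
  have hqs : d / N * s ^ 3 = c / N := by rw [hd]; field_simp
  rw [hqs, Fintype.card_fin] at key
  refine key.trans ?_
  have : 3 * s ^ 4 * (d / N) * (N : ℝ) ^ 3 = 3 * s * c * N ^ 2 := by rw [hd]; field_simp
  rw [this]
  gcongr

section Link

variable {V : Type*} [DecidableEq V] [Fintype V]

/-- The triangles `T` disjoint from `A` with `A ∪ T ∈ Z`. -/
def link (Z : Finset (Finset V)) (A : Finset V) : Finset (Finset V) :=
  {T ∈ powersetCard 3 univ | Disjoint A T ∧ A ∪ T ∈ Z}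

theorem mem_link {Z : Finset (Finset V)} {A T : Finset V} :
    T ∈ link Z A ↔ #T = 3 ∧ Disjoint A T ∧ A ∪ T ∈ Z := by
  simp [link, mem_powersetCard]

theorem codegree_link {Z : Finset (Finset V)} {A e : Finset V} (hZ : ∀ σ ∈ Z, #σ = #A + 3)
    (he : Disjoint A e) : codegree (link Z A) e = codegree Z (A ∪ e) := by
  refine card_bij' (fun T _ => A ∪ T) (fun σ _ => σ \ A) ?_ ?_ ?_ ?_
  · intro T hT
    obtain ⟨hT, heT⟩ := mem_filter.1 hT
    exact mem_filter.2 ⟨(mem_link.1 hT).2.2, union_subset_union_right heT⟩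
  · intro σ hσ
    obtain ⟨hσ, hs⟩ := mem_filter.1 hσ
    have hA : A ⊆ σ := subset_union_left.trans hs
    refine mem_filter.2 ⟨mem_link.2 ⟨?_, disjoint_sdiff, ?_⟩,
      subset_sdiff.2 ⟨subset_union_right.trans hs, he.symm⟩⟩
    · rw [card_sdiff_of_subset hA, hZ σ hσ, Nat.add_sub_cancel_left]
    · rwa [union_sdiff_of_subset hA]
  · intro T hT
    exact union_sdiff_cancel_left (mem_link.1 (mem_filter.1 hT).1).2.1
  · intro σ hσ
    exact union_sdiff_of_subset (subset_union_left.trans (mem_filter.1 hσ).2)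

theorem isEvenCover_link {k : ℕ} {Z : Finset (Finset V)} {A : Finset V} (hA : #A = k)
    (hZ : ∀ σ ∈ Z, #σ = k + 3) (heven : IsEvenCover (k + 2) Z) : IsEvenCover 2 (link Z A) := by
  intro e he
  by_cases hd : Disjoint A e
  · rw [codegree_link (by rwa [hA]) hd]
    exact heven _ (by rw [card_union_of_disjoint hd, hA, he])
  · have : codegree (link Z A) e = 0 := by
      rw [codegree, card_eq_zero, filter_eq_empty_iff]
      intro T hT heT
      exact hd ((mem_link.1 hT).2.1.mono_right heT)
    rw [this]
    exact Even.zero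

/-- If every nonempty link of a `k`-set has many adjacent pairs, then every nonempty link of a
smaller set has many faces. -/
theorem le_codegree_of_forall_link {k : ℕ} {Z : Finset (Finset V)} {lam : ℝ} (hlam : 0 < lam)
    (hZ : ∀ σ ∈ Z, #σ = k + 3)
    (hlink : ∀ A : Finset V, #A = k → (link Z A).Nonempty →
      lam * (Fintype.card V : ℝ) ^ 2 ≤ (∑ u, #(neighbors (link Z A) u) : ℝ))
    (j : ℕ) (A : Finset V) (hA : #A + j = k) (hpos : 0 < codegree Z A) :
    (lam * Fintype.card V / (k + 3)) ^ j * (lam * (Fintype.card V : ℝ) ^ 2 / 6) ≤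
      codegree Z A := by
  have link_nonempty : ∀ A : Finset V, #A = k → 0 < codegree Z A → (link Z A).Nonempty := by
    intro A hA hpos
    have h := codegree_link (Z := Z) (A := A) (e := ∅) (by rwa [hA]) (disjoint_empty_right A)
    rw [union_empty] at h
    rw [← h] at hpos
    exact (card_pos.1 hpos).mono (filter_subset _ _)
  induction j generalizing A with
  | zero =>
    have hA' : #A = k := by simpa using hA
    have h := codegree_link (Z := Z) (A := A) (e := ∅) (by rwa [hA']) (disjoint_empty_right A)
    have h1 := hlink A hA' (link_nonempty A hA' hpos)
    have h2 : (∑ u, #(neighbors (link Z A) u) : ℝ) ≤ 6 * #(link Z A) := by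
      exact_mod_cast sum_card_neighbors_le fun T hT => (mem_link.1 hT).1
    have h3 : codegree Z A = #(link Z A) := by
      rw [union_empty] at h
      rw [← h]
      simp [codegree]
    rw [pow_zero, one_mul, h3]
    linarith
  | succ j ih =>
    obtain ⟨σ, hσ⟩ := card_pos.1 hpos
    obtain ⟨hσZ, hAσ⟩ := mem_filter.1 hσ
    obtain ⟨A', hAA', hA'σ, hA'⟩ := exists_subsuperset_card_eq hAσ (by omega : #A ≤ k)
      (by rw [hZ σ hσZ]; omega)
    have hbig := hlink A' hA' (link_nonempty A' hA' (card_pos.2 ⟨σ, mem_filter.2 ⟨hσZ, hA'σ⟩⟩))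
    set N : ℝ := (Fintype.card V : ℝ) with hN
    have hN0 : 0 < N := by
      obtain ⟨x, -⟩ := card_pos.1 (by rw [hZ σ hσZ]; omega : 0 < #σ)
      exact Nat.cast_pos.2 (Fintype.card_pos_iff.2 ⟨x⟩)
    set U : Finset V := {u | (neighbors (link Z A') u).Nonempty} with hU
    have hUcard : lam * N ≤ #U := by
      have h1 : (∑ u, #(neighbors (link Z A') u) : ℝ) ≤ #U * N := by
        rw [← nsmul_eq_mul, ← sum_const, hU, sum_filter]
        refine sum_le_sum fun u _ => ?_
        split_ifs with h
        · exact Nat.cast_le.2 (card_le_univ _)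
        · rw [not_nonempty_iff_eq_empty.1 h, card_empty, Nat.cast_zero]
      have h2 : lam * N * N ≤ #U * N := by linarith
      exact le_of_mul_le_mul_right h2 hN0
    have hext : ∀ u ∈ U, (lam * N / (k + 3)) ^ j * (lam * N ^ 2 / 6) ≤
        codegree Z (insert u A) := by
      intro u hu
      obtain ⟨v, hv⟩ := (mem_filter.1 hu).2
      obtain ⟨-, T, hT, huT, -⟩ := (mem_filter.1 hv).2
      obtain ⟨-, hd, hTZ⟩ := mem_link.1 hT
      have huA : u ∉ A := fun h => disjoint_left.1 hd (hAA' h) huT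
      refine ih (insert u A) (by rw [card_insert_of_notMem huA]; omega)
        (card_pos.2 ⟨_, mem_filter.2 ⟨hTZ, ?_⟩⟩)
      exact insert_subset (mem_union_right _ huT) (hAA'.trans subset_union_left)
    have hsum : (∑ u ∈ U, codegree Z (insert u A) : ℝ) ≤ (k + 3) * codegree Z A := by
      exact_mod_cast sum_codegree_insert_le (fun σ hσ => (hZ σ hσ).le) A U
    have hlow := card_nsmul_le_sum U _ _ hext
    rw [nsmul_eq_mul] at hlow
    set E := (lam * N / (k + 3)) ^ j * (lam * N ^ 2 / 6) with hE
    have hE0 : 0 ≤ E := by positivity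
    have h3 : lam * N * E ≤ (k + 3) * codegree Z A :=
      (mul_le_mul_of_nonneg_right hUcard hE0).trans (hlow.trans hsum)
    have hk : (0 : ℝ) < k + 3 := by positivity
    calc (lam * N / (k + 3)) ^ (j + 1) * (lam * N ^ 2 / 6) = lam * N * E / (k + 3) := by
          rw [hE]; ring
      _ ≤ codegree Z A := by
          rw [div_le_iff₀ hk]; linarith

theorem exists_minimal_evenCover {L : Finset (Finset V)} (hL : L.Nonempty)
    (heven : IsEvenCover 2 L) : ∃ M ⊆ L, M.Nonempty ∧ IsEvenCover 2 M ∧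
      ∀ S ⊆ M, S.Nonempty → IsEvenCover 2 S → S = M := by
  obtain ⟨M, hML, hM⟩ := (Set.toFinite {S : Finset (Finset V) | S.Nonempty ∧
    IsEvenCover 2 S}).exists_le_minimal ⟨hL, heven⟩
  exact ⟨M, hML, hM.prop.1, hM.prop.2, fun S hS hne hev => hM.eq_of_le ⟨hne, hev⟩ hS⟩

/-- A cycle none of whose links contains a small cycle is large. -/
theorem le_card_of_forall_smallCycles {k : ℕ} {Z : Finset (Finset V)} {lam : ℝ} (hlam : 0 < lam)
    (hZ : ∀ σ ∈ Z, #σ = k + 3) (heven : IsEvenCover (k + 2) Z) (hne : Z.Nonempty)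
    (havoid : ∀ A : Finset V, #A = k →
      ∀ M ∈ smallCycles V (lam * (Fintype.card V : ℝ) ^ 2), ¬ M ⊆ link Z A) :
    (lam / (k + 3)) ^ k * (lam / 6) * (Fintype.card V : ℝ) ^ (k + 2) ≤ #Z := by
  have hcod : codegree Z ∅ = #Z := by simp [codegree]
  have h := le_codegree_of_forall_link hlam hZ ?_ k ∅ (by simp) (hcod ▸ card_pos.2 hne)
  · rw [hcod] at h
    refine le_trans (le_of_eq ?_) h
    ring
  · intro A hA hlne
    obtain ⟨M, hML, hMne, hMev, hMmin⟩ :=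
      exists_minimal_evenCover hlne (isEvenCover_link hA hZ heven)
    by_contra! hlt
    refine havoid A hA M (mem_smallCycles.2 ⟨hMne, fun T hT => (mem_link.1 (hML hT)).1, hMev,
      hMmin, le_trans ?_ hlt.le⟩) hML
    exact sum_le_sum fun u _ => by exact_mod_cast card_le_card (neighbors_mono hML u)

end Link

/-- A dense family of `(k + 3)`-sets without small cycles in the links of `k`-sets. -/
theorem exists_family_avoiding_smallCycles (k K : ℕ) (hK : 0 < K) :
    ∃ lam : ℝ, 0 < lam ∧ ∃ N₀ : ℕ, ∀ N : ℕ, N₀ ≤ N →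
      ∃ X : Finset (Finset (Fin N)), (∀ σ ∈ X, #σ = k + 3) ∧ #X = K * N.choose (k + 2) ∧
        ∀ A : Finset (Fin N), #A = k →
          ∀ M ∈ smallCycles (Fin N) (lam * N ^ 2), ¬ M ⊆ link X A := by
  have hK' : (0 : ℝ) < K := by exact_mod_cast hK
  set c : ℝ := 4 * (k + 3) * K with hc
  set δ : ℝ := K / (4 * (k + 1) * (k + 2)) with hδ
  have hc0 : 0 < c := by positivity
  have hδ0 : 0 < δ := by positivity
  obtain ⟨lam, hlam, N₀, hN₀⟩ := exists_sum_smallCycles_le hc0 hδ0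
  obtain ⟨N₁, hN₁⟩ := exists_nat_gt c
  refine ⟨lam, hlam, max N₀ (max N₁ (2 * k + 4)), fun N hN => ?_⟩
  simp only [max_le_iff] at hN
  obtain ⟨hNN₀, hNN₁, hNk⟩ := hN
  have hN0 : (0 : ℝ) < N := by exact_mod_cast (by omega : 0 < N)
  have hcN : c < N := hN₁.trans_le (by exact_mod_cast hNN₁)
  have hNk' : (2 * k + 4 : ℝ) ≤ N := by exact_mod_cast hNk
  set p : ℝ := c / N with hp
  have hp0 : 0 < p := by positivity
  have hp1 : p < 1 := by rwa [hp, div_lt_one hN0]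
  set I : Finset (Finset (Fin N) × Finset (Finset (Fin N))) :=
    {x ∈ powersetCard k univ ×ˢ smallCycles (Fin N) (lam * N ^ 2) |
      ∀ T ∈ x.2, Disjoint x.1 T} with hI
  have hmemI : ∀ x ∈ I, #x.1 = k ∧ x.2 ∈ smallCycles (Fin N) (lam * N ^ 2) ∧
      ∀ T ∈ x.2, Disjoint x.1 T := by
    intro x hx
    obtain ⟨hx1, hx2⟩ := mem_filter.1 hx
    obtain ⟨h1, h2⟩ := mem_product.1 hx1
    exact ⟨(mem_powersetCard.1 h1).2, h2, hx2⟩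
  obtain ⟨Y, hYF, hYavoid, hYcard⟩ := exists_subset_avoiding
    (powersetCard (k + 3) (univ : Finset (Fin N))) I (fun x => x.2.image fun T => x.1 ∪ T)
    (by
      intro x hx
      obtain ⟨hA, hZ, hd⟩ := hmemI x hx
      obtain ⟨hne, h3, -⟩ := mem_smallCycles.1 hZ
      refine ⟨image_subset_iff.2 fun T hT => mem_powersetCard.2 ⟨subset_univ _, ?_⟩, hne.image _⟩
      rw [card_union_of_disjoint (hd T hT), hA, h3 T hT]) hp0 hp1
  have hbad : ∑ x ∈ I, p ^ #(x.2.image fun T => x.1 ∪ T) ≤ N.choose k * (δ * N ^ 2) := by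
    have h1 : ∀ x ∈ I, p ^ #(x.2.image fun T => x.1 ∪ T) = p ^ #x.2 := by
      intro x hx
      rw [card_image_of_injOn]
      intro T hT T' hT' h
      have hd := (hmemI x hx).2.2
      rw [← union_sdiff_cancel_left (hd T hT), ← union_sdiff_cancel_left (hd T' hT')]
      exact congrArg (· \ x.1) h
    rw [sum_congr rfl h1]
    calc ∑ x ∈ I, p ^ #x.2
        ≤ ∑ x ∈ powersetCard k (univ : Finset (Fin N)) ×ˢ smallCycles (Fin N) (lam * N ^ 2),
            p ^ #x.2 :=
          sum_le_sum_of_subset_of_nonneg (filter_subset _ _) fun _ _ _ => by positivity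
      _ = N.choose k * ∑ Z ∈ smallCycles (Fin N) (lam * N ^ 2), p ^ #Z := by
          rw [sum_product]
          dsimp only
          rw [sum_const, card_powersetCard, card_univ, Fintype.card_fin,
            nsmul_eq_mul]
      _ ≤ _ := mul_le_mul_of_nonneg_left (hN₀ N hNN₀) (Nat.cast_nonneg _)
  have choose_succ : ∀ j ≤ N, (N.choose (j + 1) : ℝ) * (j + 1) = N.choose j * (N - j) := by
    intro j hj
    have := Nat.choose_succ_right_eq N j
    rw [← Nat.cast_sub hj]
    exact_mod_cast this
  have hc1 := choose_succ k (by omega)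
  have hc2 := choose_succ (k + 1) (by omega)
  have hc3 := choose_succ (k + 2) (by omega)
  push_cast at hc2 hc3
  have hsmall : N.choose k * (δ * N ^ 2) ≤ K * N.choose (k + 2) := by
    have h1 : (N.choose (k + 2) : ℝ) * ((k + 1) * (k + 2)) =
        N.choose k * ((N - k) * (N - (k + 1))) := by
      linear_combination (k + 1 : ℝ) * hc2 + (N - (k + 1) : ℝ) * hc1
    have h2 : (N / 2 : ℝ) * (N / 2) ≤ (N - k) * (N - (k + 1)) :=
      mul_le_mul (by linarith) (by linarith) (by positivity) (by linarith)
    have h3 := mul_le_mul_of_nonneg_left h2 (Nat.cast_nonneg (N.choose k) : (0 : ℝ) ≤ _)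
    rw [← h1] at h3
    have h4 : N.choose k * (δ * (N : ℝ) ^ 2) =
        K / ((k + 1) * (k + 2)) * (N.choose k * ((N / 2 : ℝ) * (N / 2))) := by
      rw [hδ]; field_simp; ring
    rw [h4]
    refine (mul_le_mul_of_nonneg_left h3 (by positivity)).trans (le_of_eq ?_)
    field_simp
  have hlarge : 2 * K * N.choose (k + 2) ≤ p * N.choose (k + 3) := by
    have h1 : (N.choose (k + 2) : ℝ) * (N / 2) ≤ N.choose (k + 3) * (k + 3) := by
      have h2 : (N.choose (k + 2) : ℝ) * (N / 2) ≤ N.choose (k + 2) * (N - (k + 2)) :=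
        mul_le_mul_of_nonneg_left (by linarith) (Nat.cast_nonneg _)
      linarith
    have h4 : p * N.choose (k + 3) = 4 * K / N * (N.choose (k + 3) * (k + 3)) := by
      rw [hp, hc]; field_simp
    rw [h4]
    refine le_trans (le_of_eq ?_) (mul_le_mul_of_nonneg_left h1 (by positivity))
    field_simp
    ring
  have hY : K * N.choose (k + 2) ≤ #Y := by
    rw [card_powersetCard, card_univ, Fintype.card_fin] at hYcard
    have : (K * N.choose (k + 2) : ℝ) ≤ #Y := by linarith
    exact_mod_cast this
  obtain ⟨X, hXY, hX⟩ := exists_subset_card_eq hY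
  refine ⟨X, fun σ hσ => (mem_powersetCard.1 (hYF (hXY hσ))).2, hX, fun A hA M hM hsub => ?_⟩
  refine hYavoid (A, M) (mem_filter.2 ⟨mem_product.2 ⟨mem_powersetCard.2 ⟨subset_univ _, hA⟩, hM⟩,
    fun T hT => (mem_link.1 (hsub hT)).2.1⟩) (image_subset_iff.2 fun T hT => ?_)
  exact hXY (mem_link.1 (hsub hT)).2.2

end HomologicalCode

open HomologicalCode
/-- Existence of good homological codes (Theorem 4.1 of [ALLM13]): for fixed
`n ≥ 2` and any `K > 0` there is `λ > 0` such that for all sufficiently large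
`N` there is a family `X` of `(n+1)`-element subsets of `{1,…,N}` (the top faces
of an `n`-complex) with `|X| = K·C(N,n)`, such that every nonzero `z : X → F₂`
in the kernel of the boundary map `∂_n` (for every `n`-set `τ`, the number of
`σ ∈ X` with `z σ = 1` and `τ ⊆ σ` is even, i.e. the sum over them vanishes
in `F₂`) has support of size at least `λ·C(N,n)`. -/
theorem exists_good_homological_code (n : ℕ) (hn : 2 ≤ n) (K : ℕ) (hK : 0 < K) :
    ∃ lam : ℝ, 0 < lam ∧ ∃ N₀ : ℕ, ∀ N : ℕ, N₀ ≤ N →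
      ∃ X : Finset (Finset (Fin N)),
        (∀ σ ∈ X, σ.card = n + 1) ∧
        X.card = K * N.choose n ∧
        ∀ z : Finset (Fin N) → ZMod 2,
          (∀ σ : Finset (Fin N), z σ ≠ 0 → σ ∈ X) →
          (∀ τ : Finset (Fin N), τ.card = n →
            ∑ σ ∈ X.filter (fun σ => τ ⊆ σ), z σ = 0) →
          z ≠ 0 →
          lam * N.choose n ≤ ((X.filter (fun σ => z σ ≠ 0)).card : ℝ) := by
  obtain ⟨k, rfl⟩ := Nat.exists_eq_add_of_le' hn
  obtain ⟨lam, hlam, N₀, h⟩ := exists_family_avoiding_smallCycles k K hK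
  refine ⟨(lam / (k + 3)) ^ k * (lam / 6), by positivity, N₀, fun N hN => ?_⟩
  obtain ⟨X, hXcard, hX, havoid⟩ := h N hN
  refine ⟨X, hXcard, hX, fun z hz hbd hz0 => ?_⟩
  set Z := X.filter fun σ => z σ ≠ 0 with hZ
  have heven : IsEvenCover (k + 2) Z := by
    intro τ hτ
    rw [← ZMod.natCast_eq_zero_iff_even, ← hbd τ hτ, codegree, hZ, filter_filter,
      ← sum_boole, sum_filter]
    refine sum_congr rfl fun σ _ => ?_
    generalize z σ = a
    by_cases hs : τ ⊆ σ <;> revert a <;> simp [hs]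
    decide
  have hne : Z.Nonempty := by
    obtain ⟨σ, hσ⟩ := Function.ne_iff.1 hz0
    exact ⟨σ, mem_filter.2 ⟨hz σ hσ, hσ⟩⟩
  have key := le_card_of_forall_smallCycles hlam
    (fun σ hσ => hXcard σ (mem_filter.1 hσ).1) heven hne (fun A hA M hM hsub => ?_)
  · rw [Fintype.card_fin] at key
    refine le_trans (mul_le_mul_of_nonneg_left ?_ (by positivity)) key
    exact_mod_cast Nat.choose_le_pow N (k + 2)
  · rw [Fintype.card_fin] at hM
    refine havoid A hA M hM (hsub.trans fun T hT => ?_)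
    obtain ⟨h1, h2, h3⟩ := mem_link.1 hT
    exact mem_link.2 ⟨h1, h2, (mem_filter.1 h3).1⟩
end
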